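/- arXiv:2005.14240 — 4 statements merged into one kernel-verified Lean document; each statement's English description precedes it below -/
import Mathlib

section
/- For every polynomial (A, B) and every family of image-preserving equations over it, the image-preserving QW-type exists: there is an algebra (Q, q) for the polynomial that satisfies every equation in the family, such that for every algebra (X, t) satisfying every equation in the family there exists exactly one homomorphism from (Q, q) to (X, t). -/
universe u

/-- An image-preserving equation over the polynomial `(A, B)`: a type `V` of
variables, constructors `a b : A`, and maps `l : B a → V`, `r : B b → V`
with equal range. -/
structure IPEquation (A : Type u) (B : A → Type u) : Type (u + 1) where
  V : Type u
  a : A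
  b : A
  l : B a → V
  r : B b → V
  range_eq : Set.range l = Set.range r

/-- An algebra `(X, s)` for the polynomial satisfies an image-preserving
equation if for every assignment of the variables, the two sides agree. -/
def SatisfiesEq {A : Type u} {B : A → Type u} {X : Type u}
    (s : (Σ a : A, (B a → X)) → X) (e : IPEquation A B) : Prop :=
  ∀ h : e.V → X, s ⟨e.a, h ∘ e.l⟩ = s ⟨e.b, h ∘ e.r⟩

/-- `h` is a homomorphism from the algebra `(X, s)` to the algebra `(Y, t)`. -/
def IsHom {A : Type u} {B : A → Type u} {X Y : Type u}
    (s : (Σ a : A, (B a → X)) → X) (t : (Σ a : A, (B a → Y)) → Y)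
    (h : X → Y) : Prop :=
  ∀ (a : A) (f : B a → X), h (s ⟨a, f⟩) = t ⟨a, h ∘ f⟩

/-- The least congruence on the W-type `WType B` containing all instances of the equations. -/
inductive WCongruence {A : Type u} {B : A → Type u} {E : Type u} (eqs : E → IPEquation A B) :
    WType B → WType B → Prop
  | congr (a : A) (f g : B a → WType B) (hfg : ∀ b, WCongruence eqs (f b) (g b)) :
      WCongruence eqs (WType.mk a f) (WType.mk a g)
  | equation (e : E) (h : (eqs e).V → WType B) :
      WCongruence eqs (WType.mk (eqs e).a (h ∘ (eqs e).l)) (WType.mk (eqs e).b (h ∘ (eqs e).r))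
  | symm {x y : WType B} (hxy : WCongruence eqs x y) : WCongruence eqs y x
  | trans {x y z : WType B} (hxy : WCongruence eqs x y) (hyz : WCongruence eqs y z) :
      WCongruence eqs x z

namespace WCongruence

variable {A : Type u} {B : A → Type u} {E : Type u} (eqs : E → IPEquation A B)

theorem refl (x : WType B) : WCongruence eqs x x := by
  induction x with
  | mk a f ih => exact .congr a f f ih

/-- The setoid on the W-type given by the congruence. -/
def setoid : Setoid (WType B) where
  r := WCongruence eqs
  iseqv := ⟨refl eqs, .symm, .trans⟩

/-- The algebra structure on the quotient of the W-type by the congruence. -/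
noncomputable def quotientAlgebra (x : Σ a : A, (B a → Quotient (setoid eqs))) :
    Quotient (setoid eqs) :=
  Quotient.mk _ (WType.mk x.1 fun b => (x.2 b).out)

theorem quotientAlgebra_mk (a : A) (f : B a → WType B) :
    quotientAlgebra eqs ⟨a, fun b => Quotient.mk _ (f b)⟩ = Quotient.mk _ (WType.mk a f) :=
  Quotient.sound (.congr a _ _ fun b => Quotient.mk_out (s := setoid eqs) (f b))

theorem satisfiesEq_quotientAlgebra (e : E) : SatisfiesEq (quotientAlgebra eqs) (eqs e) :=
  fun h => Quotient.sound (.equation e fun v => (h v).out)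

variable {eqs}

theorem elim_eq {X : Type u} {t : (Σ a : A, (B a → X)) → X}
    (ht : ∀ e : E, SatisfiesEq t (eqs e)) {x y : WType B} (hxy : WCongruence eqs x y) :
    WType.elim X t x = WType.elim X t y := by
  induction hxy with
  | congr a f g _ ih => simp only [WType.elim, ih]
  | equation e h => exact ht e (WType.elim X t ∘ h)
  | symm _ ih => exact ih.symm
  | trans _ _ ih₁ ih₂ => exact ih₁.trans ih₂

theorem existsUnique_isHom {X : Type u} {t : (Σ a : A, (B a → X)) → X}
    (ht : ∀ e : E, SatisfiesEq t (eqs e)) :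
    ∃! h : Quotient (setoid eqs) → X, IsHom (quotientAlgebra eqs) t h := by
  refine ⟨Quotient.lift (WType.elim X t) fun _ _ => elim_eq ht, fun a f => ?_, fun h hh => ?_⟩
  · obtain ⟨g, rfl⟩ : ∃ g : B a → WType B, f = fun b => Quotient.mk _ (g b) :=
      ⟨fun b => (f b).out, funext fun b => (Quotient.out_eq (f b)).symm⟩
    rw [quotientAlgebra_mk]
    rfl
  · funext x
    induction x using Quotient.inductionOn with
    | h w =>
      induction w with
      | mk a f ih =>
        rw [← quotientAlgebra_mk, hh, quotientAlgebra_mk]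
        exact congrArg (fun g => t ⟨a, g⟩) (funext ih)

end WCongruence

/-- Every image-preserving QW-type exists: for any polynomial `(A, B)` and any
family of image-preserving equations over it, there is an algebra satisfying
all the equations which is initial among such algebras. -/
theorem ip_qw_types_exist (A : Type u) (B : A → Type u) (E : Type u)
    (eqs : E → IPEquation A B) :
    ∃ (Q : Type u) (q : (Σ a : A, (B a → Q)) → Q),
      (∀ e : E, SatisfiesEq q (eqs e)) ∧
      ∀ (X : Type u) (t : (Σ a : A, (B a → X)) → X),
        (∀ e : E, SatisfiesEq t (eqs e)) →
        ∃! h : Q → X, IsHom q t h :=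
  ⟨Quotient (WCongruence.setoid eqs), WCongruence.quotientAlgebra eqs,
    WCongruence.satisfiesEq_quotientAlgebra eqs, fun _ _ ht => WCongruence.existsUnique_isHom ht⟩
end

section
/- Let S := Σ a : A, Set (B a). Suppose (X, t) is an algebra for the polynomial (A, B) that satisfies every image-preserving equation whose variable type is S. Then there is a unique function h from the type {x : ZFSet // x is hereditarily small relative to B} to X such that for every a : A and every f : B a → {x : ZFSet // x is hereditarily small relative to B}, h applied to the ZF set whose elements are exactly the (underlying) values of f equals t ⟨a, h ∘ f⟩. -/
universe u v w

/-- A ZF set `x` is hereditarily small relative to the family `B : A → Type u`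
if `x` is small relative to `B` (some `f : B a → ZFSet` enumerates exactly the
elements of `x`) and every element of `x` is hereditarily small relative to
`B`.  (Since `∈` is well founded on `ZFSet`, this inductive predicate is
exactly the predicate defined by `∈`-recursion.) -/
inductive HereditarilySmall {A : Type v} (B : A → Type u) : ZFSet.{u} → Prop
  | intro (x : ZFSet.{u})
      (small : ∃ (a : A) (f : B a → ZFSet.{u}), ∀ y, y ∈ x ↔ ∃ b, f b = y)
      (hered : ∀ y ∈ x, HereditarilySmall B y) : HereditarilySmall B x

/-- The set whose elements are exactly the underlying values of a family of
hereditarily small sets is again hereditarily small. -/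
theorem hereditarilySmall_range {A : Type v} {B : A → Type u} (a : A)
    (f : B a → {x : ZFSet.{u} // HereditarilySmall B x}) :
    HereditarilySmall B (ZFSet.range fun b => (f b).1) := by
  refine .intro _ ⟨a, fun b => (f b).1, fun y => ?_⟩ ?_
  · simp [ZFSet.mem_range]
  · intro y hy
    rw [ZFSet.mem_range] at hy
    obtain ⟨b, rfl⟩ := hy
    exact (f b).2

/-- An algebra satisfying the image-preserving equations with variable type
`Σ c, Set (B c)` satisfies all image-preserving equations: the range of a map
`f : B a → Y` embeds into `Σ c, Set (B c)` by taking fibres of `f`. -/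
theorem algebra_eq_of_range_eq {A : Type v} {B : A → Type u} {X : Type w}
    {t : (Σ a : A, (B a → X)) → X}
    (ht : ∀ (a b : A) (l : B a → Σ c : A, Set (B c)) (r : B b → Σ c : A, Set (B c)),
      Set.range l = Set.range r →
      ∀ h : (Σ c : A, Set (B c)) → X, t ⟨a, h ∘ l⟩ = t ⟨b, h ∘ r⟩)
    {Y : Type*} {a b : A} (f : B a → Y) (g : B b → Y)
    (hfg : Set.range f = Set.range g) (k : Y → X) :
    t ⟨a, k ∘ f⟩ = t ⟨b, k ∘ g⟩ := by
  classical
  let i : Y → Σ c : A, Set (B c) := fun y => ⟨a, f ⁻¹' {y}⟩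
  have inj {y z : Y} (hy : y ∈ Set.range f) (h : i y = i z) : y = z := by
    obtain ⟨d, rfl⟩ := hy
    have h' : f ⁻¹' {f d} = f ⁻¹' {z} := eq_of_heq (Sigma.mk.inj h).2
    exact (h' ▸ rfl : d ∈ f ⁻¹' {z})
  let j : (Σ c : A, Set (B c)) → X := fun s =>
    if hs : ∃ y ∈ Set.range f, i y = s then k hs.choose else t ⟨a, k ∘ f⟩
  have hj {y : Y} (hy : y ∈ Set.range f) : j (i y) = k y := by
    have hs : ∃ z ∈ Set.range f, i z = i y := ⟨y, hy, rfl⟩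
    have : j (i y) = k hs.choose := dif_pos hs
    rw [this, inj hs.choose_spec.1 hs.choose_spec.2]
  have hf : j ∘ i ∘ f = k ∘ f := funext fun d => hj ⟨d, rfl⟩
  have hg : j ∘ i ∘ g = k ∘ g := funext fun d => hj (hfg ▸ ⟨d, rfl⟩)
  rw [← hf, ← hg]
  exact ht a b (i ∘ f) (i ∘ g) (by rw [Set.range_comp, Set.range_comp, hfg]) j

/-- Every hereditarily small set is the range of a family of hereditarily small
sets indexed by some `B a`. -/
theorem HereditarilySmall.exists_range_eq {A : Type v} {B : A → Type u} {x : ZFSet.{u}}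
    (hx : HereditarilySmall B x) :
    ∃ (a : A) (f : B a → {x : ZFSet.{u} // HereditarilySmall B x}),
      (ZFSet.range fun b => (f b).1) = x := by
  obtain ⟨_, ⟨a, f, hf⟩, hered⟩ := hx
  refine ⟨a, fun b => ⟨f b, hered _ ((hf _).2 ⟨b, rfl⟩)⟩, ?_⟩
  ext y
  simp [ZFSet.mem_range, hf]

/-- Suppose `(X, t)` is an algebra for the polynomial `(A, B)` satisfying every
image-preserving equation whose variable type is `S := Σ a : A, Set (B a)`.
Then there is a unique function `h` from the hereditarily small sets to `X`
such that `h` applied to the set whose elements are exactly the underlying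
values of `f : B a → {x : ZFSet // HereditarilySmall B x}` equals
`t ⟨a, h ∘ f⟩`. -/
theorem unique_map_out_of_hereditarilySmall (A : Type v) (B : A → Type u)
    (X : Type w) (t : (Σ a : A, (B a → X)) → X)
    (ht : ∀ (a b : A) (l : B a → Σ c : A, Set (B c)) (r : B b → Σ c : A, Set (B c)),
      Set.range l = Set.range r →
      ∀ h : (Σ c : A, Set (B c)) → X, t ⟨a, h ∘ l⟩ = t ⟨b, h ∘ r⟩) :
    ∃! h : {x : ZFSet.{u} // HereditarilySmall B x} → X,
      ∀ (a : A) (f : B a → {x : ZFSet.{u} // HereditarilySmall B x}),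
        h ⟨ZFSet.range fun b => (f b).1, hereditarilySmall_range a f⟩ =
          t ⟨a, h ∘ f⟩ := by
  have wf : WellFounded fun x y : {x : ZFSet.{u} // HereditarilySmall B x} => x.1 ∈ y.1 :=
    InvImage.wf Subtype.val ZFSet.mem_wf
  have mem {a : A} (f : B a → {x : ZFSet.{u} // HereditarilySmall B x}) (b : B a) :
      (f b).1 ∈ ZFSet.range fun b => (f b).1 := ZFSet.mem_range.2 ⟨b, rfl⟩
  choose a f hf using fun x : {x : ZFSet.{u} // HereditarilySmall B x} => x.2.exists_range_eq
  have hmem (x : {x : ZFSet.{u} // HereditarilySmall B x}) (b : B (a x)) :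
      (f x b).1 ∈ x.1 :=
    (congrArg ((f x b).1 ∈ ·) (hf x)).mp (mem (f x) b)
  let F : {x : ZFSet.{u} // HereditarilySmall B x} → X :=
    wf.fix fun x ih => t ⟨a x, fun b => ih (f x b) (hmem x b)⟩
  have hF (x : {x : ZFSet.{u} // HereditarilySmall B x}) : F x = t ⟨a x, F ∘ f x⟩ :=
    wf.fix_eq _ x
  refine ⟨F, fun c g => ?_, fun G hG => funext fun x => ?_⟩
  · rw [hF]
    refine algebra_eq_of_range_eq ht _ _ (Set.ext fun y => ?_) F
    have key := congrArg (y.1 ∈ ·)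
      (hf ⟨ZFSet.range fun b => (g b).1, hereditarilySmall_range c g⟩)
    simpa [ZFSet.mem_range, ← Subtype.ext_iff] using key
  · induction x using wf.induction with
    | _ x ih =>
      have hx : (⟨_, hereditarilySmall_range (a x) (f x)⟩ :
          {x : ZFSet.{u} // HereditarilySmall B x}) = x := Subtype.ext (hf x)
      have hGx := hG (a x) (f x)
      rw [hx] at hGx
      have hcomp : G ∘ f x = F ∘ f x := funext fun b => ih (f x b) (hmem x b)
      rw [hF, hGx, hcomp]
end

section
/- The hereditarily countable sets form a set: there exists a ZF set H such that for every ZF set x, x ∈ H if and only if x is hereditarily countable. -/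
universe u

/-- A ZF set `x` is hereditarily countable if its collection of elements is
countable and every element of `x` is hereditarily countable.  (Since `∈` is
well founded on `ZFSet`, this inductive predicate is exactly the predicate
defined by `∈`-recursion.) -/
inductive HereditarilyCountable : ZFSet.{u} → Prop
  | intro (x : ZFSet.{u}) (ctble : x.toSet.Countable)
      (hered : ∀ y ∈ x, HereditarilyCountable y) : HereditarilyCountable x

/-- Well-founded countably branching trees, serving as codes for the hereditarily countable sets. -/
inductive CountableTree : Type
  | empty : CountableTree
  | node (f : ℕ → CountableTree) : CountableTree

namespace CountableTree

/-- The ZF set coded by a tree: a node codes the set of all sets coded by its children. -/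
noncomputable def toZFSet : CountableTree → ZFSet.{u}
  | empty => ∅
  | node f => ZFSet.range fun n => (f n).toZFSet

theorem hereditarilyCountable_toZFSet (t : CountableTree) :
    HereditarilyCountable t.toZFSet.{u} := by
  induction t with
  | empty =>
    refine .intro _ ?_ fun y hy => absurd hy (ZFSet.notMem_empty y)
    exact Set.countable_empty.mono fun y hy => ZFSet.notMem_empty y (by rwa [toZFSet] at hy)
  | node f ih =>
    refine .intro _ ?_ fun y hy => ?_
    · refine (Set.countable_range fun n => (f n).toZFSet).mono fun y hy => ?_
      change y ∈ (node f).toZFSet at hy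
      simpa [toZFSet] using hy
    · obtain ⟨n, rfl⟩ : ∃ n, (f n).toZFSet = y := by simpa [toZFSet] using hy
      exact ih n

end CountableTree

theorem HereditarilyCountable.exists_toZFSet_eq {x : ZFSet.{u}} (hx : HereditarilyCountable x) :
    ∃ t : CountableTree, t.toZFSet = x := by
  induction hx with
  | intro x ctble _ ih =>
    rcases x.eq_empty_or_nonempty with rfl | hne
    · exact ⟨.empty, by rw [CountableTree.toZFSet]⟩
    · obtain ⟨g, hg⟩ := ctble.exists_eq_range hne
      have mem_iff (y : ZFSet.{u}) : y ∈ x ↔ ∃ n, g n = y := Set.ext_iff.1 hg y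
      choose f hf using fun n => ih (g n) ((mem_iff _).2 ⟨n, rfl⟩)
      refine ⟨.node f, ZFSet.ext fun y => ?_⟩
      simp [CountableTree.toZFSet, hf, mem_iff]

/-- The hereditarily countable sets form a set: some ZF set `H` has as
elements exactly the hereditarily countable sets. -/
theorem hereditarilyCountable_is_set :
    ∃ H : ZFSet.{u}, ∀ x : ZFSet.{u}, x ∈ H ↔ HereditarilyCountable x := by
  refine ⟨ZFSet.range CountableTree.toZFSet, fun x => ?_⟩
  rw [ZFSet.mem_range]
  constructor
  · rintro ⟨t, rfl⟩
    exact t.hereditarilyCountable_toZFSet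
  · exact HereditarilyCountable.exists_toZFSet_eq
end

section
/- Every hereditarily countable ZF set has von Neumann rank strictly less than ω₂, the initial ordinal of the cardinal ℵ₂. -/
universe u

open Ordinal in
/-- Every hereditarily countable ZF set has countable rank. -/
theorem HereditarilyCountable.rank_lt_omega_one {x : ZFSet.{u}}
    (hx : HereditarilyCountable x) : ZFSet.rank x < ω_ 1 := by
  induction hx with
  | intro x ctble _ ih =>
    have : Countable x.toSet := ctble.to_subtype
    have hsup : ⨆ y : x.toSet, Order.succ (ZFSet.rank y) < ω_ 1 :=
      Ordinal.iSup_lt_omega_one fun y => (Cardinal.isSuccLimit_omega 1).succ_lt (ih y y.2)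
    refine lt_of_le_of_lt (ZFSet.rank_le_iff.2 fun y hy => ?_) hsup
    exact (Order.lt_succ _).trans_le
      (Ordinal.le_iSup (fun y : x.toSet => Order.succ (ZFSet.rank y)) ⟨y, hy⟩)

/-- Every hereditarily countable ZF set has von Neumann rank strictly less
than `ω₂`, the initial ordinal of the cardinal `ℵ₂`. -/
theorem rank_lt_omega_two_of_hereditarilyCountable (x : ZFSet.{u})
    (hx : HereditarilyCountable x) :
    ZFSet.rank x < (Cardinal.aleph 2).ord := by
  rw [Cardinal.ord_aleph]
  exact hx.rank_lt_omega_one.trans (Ordinal.omega_lt_omega.2 one_lt_two)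
end
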